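/- Let f: R^n → (0,1] be measurable and let f_t = P_t f where P_t is the Ornstein-Uhlenbeck semigroup. Then for all t > 0 and all x, ||∇f_t(x)||^2 ≤ 2 (e^{-2t}/(1 - e^{-2t})) · f_t(x) · log(1/f_t(x)). -/

import Mathlib

open MeasureTheory Real Filter
open scoped ENNReal NNReal

noncomputable def stdGaussian (n : ℕ) : Measure (Fin n → ℝ) :=
  Measure.pi fun _ => ProbabilityTheory.gaussianReal 0 1

noncomputable def gaussPhi (x : ℝ) : ℝ := (Real.sqrt (2 * Real.pi))⁻¹ * Real.exp (-(x ^ 2) / 2)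

noncomputable def gaussCdf (x : ℝ) : ℝ := ∫ y in Set.Iic x, gaussPhi y

noncomputable def gaussCdfInv : ℝ → ℝ := Function.invFun gaussCdf

/-- The Gaussian isoperimetric function `I = φ ∘ Φ⁻¹`, extended by `I(0) = I(1) = 0`. -/
noncomputable def isoI (a : ℝ) : ℝ := if a ≤ 0 ∨ 1 ≤ a then 0 else gaussPhi (gaussCdfInv a)

/-- Ornstein-Uhlenbeck semigroup. -/
noncomputable def OU (n : ℕ) (t : ℝ) (f : (Fin n → ℝ) → ℝ) (x : Fin n → ℝ) : ℝ :=
  ∫ y, f (fun i => Real.exp (-t) * x i + Real.sqrt (1 - Real.exp (-2 * t)) * y i) ∂(stdGaussian n)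

/-- Partial derivative in direction `i`. -/
noncomputable def pd {n : ℕ} (i : Fin n) (f : (Fin n → ℝ) → ℝ) (x : Fin n → ℝ) : ℝ :=
  fderiv ℝ f x (Pi.single i 1)

/-- Second partial derivative. -/
noncomputable def pd2 {n : ℕ} (i j : Fin n) (f : (Fin n → ℝ) → ℝ) (x : Fin n → ℝ) : ℝ :=
  pd j (pd i f) x

/-- Euclidean norm of the gradient. -/
noncomputable def gradNorm {n : ℕ} (f : (Fin n → ℝ) → ℝ) (x : Fin n → ℝ) : ℝ :=
  Real.sqrt (∑ i, (pd i f x) ^ 2)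

/-- Frobenius norm of the Hessian. -/
noncomputable def hessFrob {n : ℕ} (f : (Fin n → ℝ) → ℝ) (x : Fin n → ℝ) : ℝ :=
  Real.sqrt (∑ i, ∑ j, (pd2 i j f x) ^ 2)

noncomputable def frob {n : ℕ} (A : Matrix (Fin n) (Fin n) ℝ) : ℝ :=
  Real.sqrt (∑ i, ∑ j, (A i j) ^ 2)

/-- One-dimensional Hermite polynomial (physicists'/probabilists' unnormalized, as in the paper). -/
noncomputable def hermite1 (k : ℕ) (x : ℝ) : ℝ :=
  Real.exp (x ^ 2 / 2) * iteratedDeriv k (fun y => Real.exp (-(y ^ 2) / 2)) x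

/-- Multi-dimensional Hermite polynomial. -/
noncomputable def hermiteM {n : ℕ} (α : Fin n → ℕ) (x : Fin n → ℝ) : ℝ :=
  ∏ i, hermite1 (α i) (x i)

/-- Orthonormal Hermite polynomial. -/
noncomputable def hermiteG {n : ℕ} (α : Fin n → ℕ) (x : Fin n → ℝ) : ℝ :=
  hermiteM α x / Real.sqrt (∏ i, Nat.factorial (α i))

/-- `M` is a median of `f` under `μ`. -/
def IsMedian {Ω : Type*} [MeasurableSpace Ω] (μ : Measure Ω) (f : Ω → ℝ) (M : ℝ) : Prop :=
  (1 : ℝ≥0∞) / 2 ≤ μ {x | f x ≤ M} ∧ (1 : ℝ≥0∞) / 2 ≤ μ {x | M ≤ f x}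

/-- Gaussian boundary measure (perimeter), via smooth vector fields all of whose
derivatives vanish at infinity. -/
noncomputable def gaussBoundary (n : ℕ) (A : Set (Fin n → ℝ)) : ℝ :=
  sSup { r : ℝ | ∃ v : (Fin n → ℝ) → (Fin n → ℝ),
    ContDiff ℝ (⊤ : ℕ∞) v ∧
    (∀ k : ℕ, Tendsto (fun x => ‖iteratedFDeriv ℝ k v x‖) (cocompact _) (nhds 0)) ∧
    (∀ x, Real.sqrt (∑ i, (v x i) ^ 2) ≤ 1) ∧
    r = ∫ x in A, (∑ i, (pd i (fun y => v y i) x - x i * v x i)) ∂(stdGaussian n) }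

theorem gaussianReal_eq_setIntegral_exp (m : ℝ) {s : Set ℝ} (hs : MeasurableSet s) :
    ProbabilityTheory.gaussianReal m 1 s =
      ENNReal.ofReal (∫ x in s, exp (m * x - m ^ 2 / 2) ∂ProbabilityTheory.gaussianReal 0 1) := by
  rw [ProbabilityTheory.gaussianReal_apply_eq_integral _ one_ne_zero,
    ProbabilityTheory.gaussianReal_of_var_ne_zero _ one_ne_zero,
    setIntegral_withDensity_eq_setIntegral_toReal_smul
      (ProbabilityTheory.measurable_gaussianPDF _ _)
      (ae_of_all _ fun _ => ProbabilityTheory.gaussianPDF_lt_top) _ hs]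
  congr 2
  ext x
  rw [ProbabilityTheory.toReal_gaussianPDF, smul_eq_mul, ProbabilityTheory.gaussianPDFReal,
    ProbabilityTheory.gaussianPDFReal, mul_assoc _ (exp _) (exp _), ← exp_add]
  congr 2
  push_cast
  ring

instance isProbabilityMeasure_stdGaussian (n : ℕ) : IsProbabilityMeasure (stdGaussian n) := by
  unfold stdGaussian
  infer_instance

theorem integrable_exp_mul_sub (m : ℝ) :
    Integrable (fun x => exp (m * x - m ^ 2 / 2)) (ProbabilityTheory.gaussianReal 0 1) := by
  simp_rw [sub_eq_add_neg, exp_add]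
  exact (ProbabilityTheory.integrable_exp_mul_gaussianReal m).mul_const _

theorem integrable_exp_sum_stdGaussian {n : ℕ} (w : Fin n → ℝ) :
    Integrable (fun y => exp (∑ i, (w i * y i - w i ^ 2 / 2))) (stdGaussian n) := by
  simp_rw [exp_sum]
  exact Integrable.fintype_prod (f := fun i x => exp (w i * x - w i ^ 2 / 2))
    fun i => integrable_exp_mul_sub (w i)

/-- Cameron-Martin formula for translations of the standard Gaussian measure. -/
theorem map_add_stdGaussian {n : ℕ} (w : Fin n → ℝ) :
    (stdGaussian n).map (fun y => y + w) =
      (stdGaussian n).withDensity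
        (fun y => ENNReal.ofReal (exp (∑ i, (w i * y i - w i ^ 2 / 2)))) := by
  have hmap : (stdGaussian n).map (fun y => y + w) =
      Measure.pi fun i => ProbabilityTheory.gaussianReal (w i) 1 := by
    have h (i : Fin n) : (ProbabilityTheory.gaussianReal 0 1).map (fun x => x + w i) =
        ProbabilityTheory.gaussianReal (w i) 1 := by
      rw [ProbabilityTheory.gaussianReal_map_add_const, zero_add]
    have (i : Fin n) : SigmaFinite ((ProbabilityTheory.gaussianReal 0 1).map
        (fun x => x + w i)) := by
      rw [h]; infer_instance
    simp_rw [← h]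
    exact Measure.pi_map_pi (f := fun i x => x + w i) fun i => by fun_prop
  rw [hmap]
  refine Measure.pi_eq fun s hs => ?_
  rw [withDensity_apply _ (MeasurableSet.univ_pi hs),
    ← ofReal_integral_eq_lintegral_ofReal (integrable_exp_sum_stdGaussian w).integrableOn
      (ae_of_all _ fun _ => (exp_pos _).le), stdGaussian, Measure.restrict_pi_pi]
  simp_rw [exp_sum]
  rw [integral_fintype_prod_eq_prod (fun i x => exp (w i * x - w i ^ 2 / 2)),
    ENNReal.ofReal_prod_of_nonneg fun i _ => integral_nonneg fun _ => (exp_pos _).le]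
  exact Finset.prod_congr rfl fun i _ => (gaussianReal_eq_setIntegral_exp (w i) (hs i)).symm

theorem integral_exp_sum_stdGaussian {n : ℕ} (w : Fin n → ℝ) :
    ∫ y, exp (∑ i, (w i * y i - w i ^ 2 / 2)) ∂stdGaussian n = 1 := by
  have h := congrArg (fun μ => μ Set.univ) (map_add_stdGaussian w)
  simp only [withDensity_apply _ MeasurableSet.univ, Measure.restrict_univ] at h
  rw [← ofReal_integral_eq_lintegral_ofReal (integrable_exp_sum_stdGaussian w)
    (ae_of_all _ fun _ => (exp_pos _).le), Measure.map_apply (by fun_prop) MeasurableSet.univ,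
    Set.preimage_univ, measure_univ] at h
  exact (ENNReal.ofReal_eq_one.mp h.symm)

theorem integral_add_stdGaussian {n : ℕ} {F : (Fin n → ℝ) → ℝ} (hF : Measurable F)
    (w : Fin n → ℝ) :
    ∫ y, F (y + w) ∂stdGaussian n =
      ∫ y, exp (∑ i, (w i * y i - w i ^ 2 / 2)) * F y ∂stdGaussian n := by
  rw [← integral_map (φ := fun y => y + w) (by fun_prop) hF.aestronglyMeasurable,
    map_add_stdGaussian,
    integral_withDensity_eq_integral_toReal_smul (by fun_prop) (ae_of_all _ fun _ => by simp)]
  simp [ENNReal.toReal_ofReal (exp_pos _).le]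

theorem integrable_exp_mul_eval_stdGaussian {n : ℕ} (i : Fin n) (r : ℝ) :
    Integrable (fun y => exp (r * y i)) (stdGaussian n) :=
  (measurePreserving_eval
    (fun _ : Fin n => ProbabilityTheory.gaussianReal 0 1) i).integrable_comp_of_integrable
    (ProbabilityTheory.integrable_exp_mul_gaussianReal r)

theorem integrable_eval_stdGaussian {n : ℕ} (i : Fin n) :
    Integrable (fun y => y i) (stdGaussian n) :=
  (measurePreserving_eval
    (fun _ : Fin n => ProbabilityTheory.gaussianReal 0 1) i).integrable_comp_of_integrable
    ((ProbabilityTheory.memLp_id_gaussianReal 1).integrable le_rfl)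

theorem MeasureTheory.Integrable.mul_of_mem_Ioc {α : Type*} [MeasurableSpace α] {μ : Measure α}
    {g F : α → ℝ} (hg : Integrable g μ) (hF : Measurable F) (h : ∀ y, 0 < F y ∧ F y ≤ 1) :
    Integrable (fun y => g y * F y) μ :=
  hg.mul_bdd (c := 1) hF.aestronglyMeasurable
    (ae_of_all _ fun y => by rw [norm_of_nonneg (h y).1.le]; exact (h y).2)

/-- The derivative of a translated Gaussian integral, by Gaussian integration by parts. -/
theorem hasDerivAt_integral_add_stdGaussian {n : ℕ} {F : (Fin n → ℝ) → ℝ} (hF : Measurable F)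
    (hF01 : ∀ y, 0 < F y ∧ F y ≤ 1) (i : Fin n) :
    HasDerivAt (fun r : ℝ => ∫ y, F (y + Pi.single i r) ∂stdGaussian n)
      (∫ y, y i * F y ∂stdGaussian n) 0 := by
  set μ := (stdGaussian n).withDensity (fun y => ENNReal.ofReal (F y)) with hμ
  have hint (g : (Fin n → ℝ) → ℝ) : ∫ y, g y ∂μ = ∫ y, g y * F y ∂stdGaussian n := by
    rw [hμ, integral_withDensity_eq_integral_toReal_smul (by fun_prop)
      (ae_of_all _ fun _ => by simp)]
    simp [ENNReal.toReal_ofReal (hF01 _).1.le, mul_comm]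
  have hmem : (0 : ℝ) ∈ interior (ProbabilityTheory.integrableExpSet (fun y => y i) μ) := by
    have : ProbabilityTheory.integrableExpSet (fun y : Fin n → ℝ => y i) μ = Set.univ := by
      refine Set.eq_univ_of_forall fun r => ?_
      change Integrable (fun y : Fin n → ℝ => exp (r * y i)) μ
      rw [hμ, integrable_withDensity_iff_integrable_smul' (by fun_prop)
        (ae_of_all _ fun _ => by simp)]
      simpa [ENNReal.toReal_ofReal (hF01 _).1.le, mul_comm] using
        (integrable_exp_mul_eval_stdGaussian i r).mul_of_mem_Ioc hF hF01
    simp [this]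
  have hshift (r : ℝ) : ∫ y, F (y + Pi.single i r) ∂stdGaussian n =
      exp (-(r ^ 2 / 2)) * ProbabilityTheory.mgf (fun y => y i) μ r := by
    rw [integral_add_stdGaussian hF, ProbabilityTheory.mgf, hint, ← integral_const_mul]
    congr with y
    rw [← mul_assoc, ← exp_add, Finset.sum_eq_single i (fun j _ hj => by simp [hj]) (by simp),
      Pi.single_eq_same, sub_eq_neg_add]
  simp_rw [hshift]
  have h1 : HasDerivAt (fun r : ℝ => exp (-(r ^ 2 / 2))) 0 0 := by
    have := (((hasDerivAt_id (0 : ℝ)).pow 2).div_const 2).neg.exp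
    simpa using this
  convert! h1.mul (ProbabilityTheory.hasDerivAt_mgf hmem) using 1
  simp [hint]

/-- The entropy inequality between a density bounded by one and linear functionals. -/
theorem sum_sq_integral_mul_le {n : ℕ} {F : (Fin n → ℝ) → ℝ} (hF : Measurable F)
    (hF01 : ∀ y, 0 < F y ∧ F y ≤ 1) (hpos : 0 < ∫ y, F y ∂stdGaussian n) :
    ∑ i, (∫ y, y i * F y ∂stdGaussian n) ^ 2 ≤
      2 * (∫ y, F y ∂stdGaussian n) ^ 2 * log (1 / ∫ y, F y ∂stdGaussian n) := by
  set m := ∫ y, F y ∂stdGaussian n with hm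
  set a : Fin n → ℝ := fun i => ∫ y, y i * F y ∂stdGaussian n with ha
  set S := ∑ i, (a i) ^ 2 with hS
  have hFi : Integrable F (stdGaussian n) := by
    simpa using (integrable_const (1 : ℝ)).mul_of_mem_Ioc hF hF01
  have hai (i : Fin n) := (integrable_eval_stdGaussian i).mul_of_mem_Ioc hF hF01
  set w : Fin n → ℝ := fun i => a i / m with hw
  set c := S / m ^ 2 / 2 with hc
  have hw2 : ∑ i, w i ^ 2 / 2 = c := by
    simp_rw [hw, div_pow, hc, hS, Finset.sum_div]
  have hwa : ∑ i, w i * a i = 2 * c * m := by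
    have : ∀ i, w i * a i = a i ^ 2 / m := fun i => by simp only [hw]; ring
    simp_rw [this, ← Finset.sum_div, hc]
    field_simp
    rfl
  have hlin : ∫ y, (∑ i, (w i * y i - w i ^ 2 / 2)) * F y ∂stdGaussian n = c * m := by
    have : ∀ y : Fin n → ℝ, (∑ i, (w i * y i - w i ^ 2 / 2)) * F y =
        ∑ i, w i * (y i * F y) - c * F y := fun y => by
      rw [Finset.sum_sub_distrib, hw2, sub_mul, Finset.sum_mul]
      simp_rw [mul_assoc]
    simp_rw [this]
    rw [integral_sub (integrable_finsetSum _ fun i _ => (hai i).const_mul _) (hFi.const_mul _),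
      integral_finsetSum _ fun i _ => (hai i).const_mul _]
    simp_rw [integral_const_mul]
    change ∑ i, w i * a i - c * m = _
    rw [hwa]; ring
  have hlin_int : Integrable (fun y => (∑ i, (w i * y i - w i ^ 2 / 2)) * F y) (stdGaussian n) :=
    (integrable_finsetSum _ fun i _ =>
      ((integrable_eval_stdGaussian i).const_mul _).sub (integrable_const _)).mul_of_mem_Ioc hF hF01
  have key : exp c * m ≤ 1 := by
    calc exp c * m = ∫ y, exp c * ((∑ i, (w i * y i - w i ^ 2 / 2)) * F y
            + (1 - c) * F y) ∂stdGaussian n := by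
          rw [integral_const_mul, integral_add hlin_int (hFi.const_mul _), hlin,
            integral_const_mul]
          ring
      _ ≤ ∫ y, exp (∑ i, (w i * y i - w i ^ 2 / 2)) ∂stdGaussian n := by
          refine integral_mono ((hlin_int.add (hFi.const_mul _)).const_mul _)
            (integrable_exp_sum_stdGaussian w) fun y => ?_
          set g := ∑ i, (w i * y i - w i ^ 2 / 2)
          have h1 : exp c * (g - c + 1) ≤ exp g := by
            calc exp c * (g - c + 1) ≤ exp c * exp (g - c) := by
                  gcongr; exact add_one_le_exp _
              _ = exp g := by rw [← exp_add]; ring_nf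
          calc exp c * (g * F y + (1 - c) * F y) = exp c * (g - c + 1) * F y := by ring
            _ ≤ exp g * F y := by gcongr; exact (hF01 y).1.le
            _ ≤ exp g * 1 := by gcongr; exact (hF01 y).2
            _ = exp g := mul_one _
      _ = 1 := integral_exp_sum_stdGaussian w
  have hcl : c ≤ log (1 / m) := by
    rw [le_log_iff_exp_le (by positivity), le_div_iff₀ hpos]
    exact key
  calc S = 2 * m ^ 2 * c := by rw [hc]; field_simp
    _ ≤ 2 * m ^ 2 * log (1 / m) := by gcongr

/-- reverse log-Sobolev gradient bound. -/
theorem stmt2 (n : ℕ) (f : (Fin n → ℝ) → ℝ) (hmeas : Measurable f)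
    (hf : ∀ x, 0 < f x ∧ f x ≤ 1) (t : ℝ) (ht : 0 < t) (x : Fin n → ℝ) :
    ∑ i, (pd i (OU n t f) x) ^ 2
      ≤ 2 * (Real.exp (-2 * t) / (1 - Real.exp (-2 * t))) *
          (OU n t f x * Real.log (1 / OU n t f x)) := by
  have hs : 0 < 1 - exp (-2 * t) := by
    rw [sub_pos, exp_lt_one_iff]; linarith
  set σ := √(1 - exp (-2 * t)) with hσ
  have hσ0 : 0 < σ := sqrt_pos.mpr hs
  set F : (Fin n → ℝ) → ℝ := fun y => f (fun i => exp (-t) * x i + σ * y i) with hFdef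
  have hF : Measurable F := hmeas.comp (by fun_prop)
  have hF01 : ∀ y, 0 < F y ∧ F y ≤ 1 := fun y => hf _
  have hFi : Integrable F (stdGaussian n) := by
    simpa using (integrable_const (1 : ℝ)).mul_of_mem_Ioc hF hF01
  have hOU : OU n t f x = ∫ y, F y ∂stdGaussian n := rfl
  have hpos : 0 < OU n t f x := by
    rw [hOU, integral_pos_iff_support_of_nonneg (fun y => (hF01 y).1.le) hFi]
    have : Function.support F = Set.univ := Set.eq_univ_of_forall fun y => (hF01 y).1.ne'
    simp [this]
  have hle : OU n t f x ≤ 1 := by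
    rw [hOU]
    calc ∫ y, F y ∂stdGaussian n ≤ ∫ _, 1 ∂stdGaussian n :=
          integral_mono hFi (integrable_const _) fun y => (hF01 y).2
      _ = 1 := by simp
  have hlog : 0 ≤ log (1 / OU n t f x) := log_nonneg ((one_le_div hpos).mpr hle)
  by_cases hd : DifferentiableAt ℝ (OU n t f) x
  swap
  · simp only [pd, fderiv_zero_of_not_differentiableAt hd]
    simp only [zero_apply, ne_eq, OfNat.ofNat_ne_zero, not_false_eq_true,
      zero_pow, Finset.sum_const_zero]
    positivity
  have hpd (i : Fin n) : pd i (OU n t f) x = exp (-t) / σ * ∫ y, y i * F y ∂stdGaussian n := by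
    have h1 : HasDerivAt (fun r : ℝ => OU n t f (x + r • Pi.single i 1))
        (pd i (OU n t f) x) 0 := by
      exact hd.hasFDerivAt.hasLineDerivAt _
    have h2 : HasDerivAt (fun r : ℝ => ∫ y, F (y + Pi.single i (exp (-t) / σ * r)) ∂stdGaussian n)
        (exp (-t) / σ * ∫ y, y i * F y ∂stdGaussian n) 0 := by
      have h := hasDerivAt_integral_add_stdGaussian hF hF01 i
      rw [← mul_zero (exp (-t) / σ)] at h
      rw [mul_comm]
      exact h.comp (0 : ℝ) (by simpa using (hasDerivAt_id (0 : ℝ)).const_mul (exp (-t) / σ))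
    refine h1.unique (h2.congr_of_eventuallyEq (Eventually.of_forall fun r => ?_))
    simp only [OU, hFdef, ← hσ]
    congr with y
    congr with j
    simp only [Pi.add_apply, Pi.smul_apply, smul_eq_mul]
    by_cases hj : j = i
    · subst hj
      simp
      field_simp
      ring
    · simp [hj]
  have hcoef : (exp (-t) / σ) ^ 2 = exp (-2 * t) / (1 - exp (-2 * t)) := by
    rw [div_pow, hσ, sq_sqrt hs.le, ← exp_nat_mul]
    push_cast
    ring_nf
  simp_rw [hpd, mul_pow]
  rw [← Finset.mul_sum, hcoef]
  calc exp (-2 * t) / (1 - exp (-2 * t)) * ∑ i, (∫ y, y i * F y ∂stdGaussian n) ^ 2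
      ≤ exp (-2 * t) / (1 - exp (-2 * t)) *
          (2 * (OU n t f x) ^ 2 * log (1 / OU n t f x)) := by
        gcongr
        exact sum_sq_integral_mul_le hF hF01 hpos
    _ ≤ exp (-2 * t) / (1 - exp (-2 * t)) * (2 * OU n t f x * log (1 / OU n t f x)) := by
        gcongr
        nlinarith
    _ = _ := by ring
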